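/- Assume p < π² and f ≡ 0. For every R > 0 there exist constants c₀ ≥ 1 and c > 0, depending only on R, p, k, such that every classical solution u of the bridge equation with zero forcing and 𝓔(0) ≤ R satisfies the exponential decay estimate 𝓔(t) ≤ c₀ · 𝓔(0) · e^{−ct} for all t ≥ 0. -/

import Mathlib

open Real MeasureTheory

noncomputable section

/-- The `L²(0,1)` inner product `⟨u,v⟩`. -/
def ipL2 (u v : ℝ → ℝ) : ℝ := ∫ x in (0:ℝ)..1, u x * v x

/-- The squared `L²(0,1)` norm `‖u‖²`. -/
def nsqL2 (u : ℝ → ℝ) : ℝ := ∫ x in (0:ℝ)..1, (u x) ^ 2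

/-- Partial derivative in time. -/
def Dt (u : ℝ → ℝ → ℝ) : ℝ → ℝ → ℝ := fun t x => deriv (fun s => u s x) t

/-- Partial derivative in space. -/
def Dx (u : ℝ → ℝ → ℝ) : ℝ → ℝ → ℝ := fun t x => deriv (fun y => u t y) x

/-- A classical solution of the suspension-bridge equation
`∂ₜₜu + ∂ₓₓₓₓu + (p − ‖∂ₓu‖²)∂ₓₓu + ∂ₜu + k²u⁺ = f` on `[0,∞) × [0,1]`,
smooth up to the boundary, with pinned boundary conditions. -/
def IsClassicalSolution (p k : ℝ) (f u : ℝ → ℝ → ℝ) : Prop :=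
  ContDiff ℝ (⊤ : ℕ∞) (Function.uncurry u) ∧
  (∀ t ≥ (0:ℝ), ∀ x ∈ Set.Icc (0:ℝ) 1,
    Dt (Dt u) t x + Dx (Dx (Dx (Dx u))) t x
      + (p - nsqL2 (Dx u t)) * Dx (Dx u) t x
      + Dt u t x + k ^ 2 * max (u t x) 0 = f t x) ∧
  (∀ t ≥ (0:ℝ), u t 0 = 0 ∧ u t 1 = 0 ∧ Dx (Dx u) t 0 = 0 ∧ Dx (Dx u) t 1 = 0)

/-- The energy `E(t) = ‖∂ₜu‖² + ‖∂ₓₓu‖² + ½(‖∂ₓu‖² − p)² + k²‖u⁺‖²`. -/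
def energy (p k : ℝ) (u : ℝ → ℝ → ℝ) (t : ℝ) : ℝ :=
  nsqL2 (Dt u t) + nsqL2 (Dx (Dx u) t)
    + (1 / 2) * (nsqL2 (Dx u t) - p) ^ 2 + k ^ 2 * nsqL2 (fun x => max (u t x) 0)

/-- The reduced energy `𝓔(t) = ‖∂ₜu‖² + ‖∂ₓₓu‖²`. -/
def redEnergy (u : ℝ → ℝ → ℝ) (t : ℝ) : ℝ :=
  nsqL2 (Dt u t) + nsqL2 (Dx (Dx u) t)

section Calculus

variable {u v w : ℝ → ℝ → ℝ}

lemma hasDerivAt_Dt (hu : ContDiff ℝ (⊤ : ℕ∞) (Function.uncurry u)) (t x : ℝ) :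
    HasDerivAt (fun s => u s x) (Dt u t x) t := by
  have h : Differentiable ℝ fun s => Function.uncurry u (s, x) :=
    (hu.comp (contDiff_id.prodMk contDiff_const)).differentiable (by simp)
  exact (h t).hasDerivAt

lemma hasDerivAt_Dx (hu : ContDiff ℝ (⊤ : ℕ∞) (Function.uncurry u)) (t x : ℝ) :
    HasDerivAt (u t) (Dx u t x) x := by
  have h : Differentiable ℝ fun y => Function.uncurry u (t, y) :=
    (hu.comp (contDiff_const.prodMk contDiff_id)).differentiable (by simp)
  exact (h x).hasDerivAt

lemma Dt_eq_fderiv (hu : ContDiff ℝ (⊤ : ℕ∞) (Function.uncurry u)) (t x : ℝ) :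
    Dt u t x = fderiv ℝ (Function.uncurry u) (t, x) (1, 0) := by
  have h := (hu.differentiable (by simp) (t, x)).hasFDerivAt.comp_hasDerivAt t
    ((hasDerivAt_id t).prodMk (hasDerivAt_const t x))
  exact (hasDerivAt_Dt hu t x).unique h

lemma Dx_eq_fderiv (hu : ContDiff ℝ (⊤ : ℕ∞) (Function.uncurry u)) (t x : ℝ) :
    Dx u t x = fderiv ℝ (Function.uncurry u) (t, x) (0, 1) := by
  have h := (hu.differentiable (by simp) (t, x)).hasFDerivAt.comp_hasDerivAt x
    ((hasDerivAt_const x t).prodMk (hasDerivAt_id x))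
  exact (hasDerivAt_Dx hu t x).unique h

lemma contDiff_Dt (hu : ContDiff ℝ (⊤ : ℕ∞) (Function.uncurry u)) :
    ContDiff ℝ (⊤ : ℕ∞) (Function.uncurry (Dt u)) := by
  have h : Function.uncurry (Dt u) = fun z => fderiv ℝ (Function.uncurry u) z (1, 0) := by
    ext ⟨t, x⟩
    exact Dt_eq_fderiv hu t x
  rw [h]
  exact (hu.fderiv_right (by simp)).clm_apply contDiff_const

lemma contDiff_Dx (hu : ContDiff ℝ (⊤ : ℕ∞) (Function.uncurry u)) :
    ContDiff ℝ (⊤ : ℕ∞) (Function.uncurry (Dx u)) := by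
  have h : Function.uncurry (Dx u) = fun z => fderiv ℝ (Function.uncurry u) z (0, 1) := by
    ext ⟨t, x⟩
    exact Dx_eq_fderiv hu t x
  rw [h]
  exact (hu.fderiv_right (by simp)).clm_apply contDiff_const

lemma Dt_Dx_comm (hu : ContDiff ℝ (⊤ : ℕ∞) (Function.uncurry u)) :
    Dt (Dx u) = Dx (Dt u) := by
  ext t x
  have hd : DifferentiableAt ℝ (fderiv ℝ (Function.uncurry u)) (t, x) :=
    (hu.fderiv_right (m := (⊤ : ℕ∞)) (by simp)).differentiable (by simp) _
  have hx : Function.uncurry (Dx u) = fun z => fderiv ℝ (Function.uncurry u) z (0, 1) := by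
    ext ⟨t, x⟩
    exact Dx_eq_fderiv hu t x
  have ht : Function.uncurry (Dt u) = fun z => fderiv ℝ (Function.uncurry u) z (1, 0) := by
    ext ⟨t, x⟩
    exact Dt_eq_fderiv hu t x
  have hs : IsSymmSndFDerivAt ℝ (Function.uncurry u) (t, x) :=
    hu.contDiffAt.isSymmSndFDerivAt (by
      rw [minSmoothness_of_isRCLikeNormedField]
      exact WithTop.coe_le_coe.2 (le_top : (2 : ℕ∞) ≤ ⊤))
  rw [Dt_eq_fderiv (contDiff_Dx hu), Dx_eq_fderiv (contDiff_Dt hu), hx, ht,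
    fderiv_clm_apply hd (differentiableAt_const _), fderiv_clm_apply hd (differentiableAt_const _)]
  simpa using hs (1, 0) (0, 1)

lemma continuous_slice (hu : Continuous (Function.uncurry u)) (t : ℝ) : Continuous (u t) :=
  hu.comp (Continuous.prodMk_right t)

/-- Differentiation of an integral over `[0,1]` with respect to a parameter. -/
lemma hasDerivAt_integral_of_continuous {F F' : ℝ → ℝ → ℝ}
    (hF : Continuous (Function.uncurry F)) (hF' : Continuous (Function.uncurry F'))
    (h : ∀ t x, HasDerivAt (fun s => F s x) (F' t x) t) (t : ℝ) :
    HasDerivAt (fun s => ∫ x in (0:ℝ)..1, F s x) (∫ x in (0:ℝ)..1, F' t x) t := by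
  obtain ⟨C, hC⟩ := ((isCompact_closedBall t 1).prod
    (isCompact_Icc (a := (0:ℝ)) (b := 1))).exists_bound_of_continuousOn hF'.continuousOn
  refine (intervalIntegral.hasDerivAt_integral_of_dominated_loc_of_deriv_le (bound := fun _ => C)
    (Metric.ball_mem_nhds t one_pos) (.of_forall fun s => ?_) ?_ ?_ ?_ ?_ ?_).2
  · exact (continuous_slice hF s).aestronglyMeasurable
  · exact (continuous_slice hF t).intervalIntegrable _ _
  · exact (continuous_slice hF' t).aestronglyMeasurable
  · refine .of_forall fun x hx s hs => ?_
    rw [Set.uIoc_of_le zero_le_one] at hx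
    exact hC (s, x) ⟨Metric.ball_subset_closedBall hs, Set.Ioc_subset_Icc_self hx⟩
  · exact intervalIntegrable_const
  · exact .of_forall fun x _ s _ => h s x

lemma hasDerivAt_ipL2 (hv : ContDiff ℝ (⊤ : ℕ∞) (Function.uncurry v))
    (hw : ContDiff ℝ (⊤ : ℕ∞) (Function.uncurry w)) (t : ℝ) :
    HasDerivAt (fun s => ipL2 (v s) (w s)) (ipL2 (Dt v t) (w t) + ipL2 (v t) (Dt w t)) t := by
  have h := hasDerivAt_integral_of_continuous (F := fun s x => v s x * w s x)
    (F' := fun s x => Dt v s x * w s x + v s x * Dt w s x) (hv.continuous.mul hw.continuous)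
    (((contDiff_Dt hv).continuous.mul hw.continuous).add
      (hv.continuous.mul (contDiff_Dt hw).continuous))
    (fun s x => (hasDerivAt_Dt hv s x).mul (hasDerivAt_Dt hw s x)) t
  rw [intervalIntegral.integral_add] at h
  · exact h
  · exact ((continuous_slice (contDiff_Dt hv).continuous t).mul
      (continuous_slice hw.continuous t)).intervalIntegrable _ _
  · exact ((continuous_slice hv.continuous t).mul
      (continuous_slice (contDiff_Dt hw).continuous t)).intervalIntegrable _ _

lemma nsqL2_eq_ipL2 (f : ℝ → ℝ) : nsqL2 f = ipL2 f f := by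
  simp only [nsqL2, ipL2, sq]

lemma ipL2_comm (f g : ℝ → ℝ) : ipL2 f g = ipL2 g f := by
  simp only [ipL2, mul_comm]

lemma hasDerivAt_nsqL2 (hv : ContDiff ℝ (⊤ : ℕ∞) (Function.uncurry v)) (t : ℝ) :
    HasDerivAt (fun s => nsqL2 (v s)) (2 * ipL2 (v t) (Dt v t)) t := by
  simp only [nsqL2_eq_ipL2]
  refine (hasDerivAt_ipL2 hv hv t).congr_deriv ?_
  rw [ipL2_comm (Dt v t)]
  ring

lemma hasDerivAt_max_sq (y : ℝ) : HasDerivAt (fun y : ℝ => max y 0 ^ 2) (2 * max y 0) y := by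
  rcases lt_trichotomy y 0 with hy | rfl | hy
  · rw [max_eq_right hy.le, mul_zero]
    refine (hasDerivAt_const y (0:ℝ)).congr_of_eventuallyEq ?_
    filter_upwards [gt_mem_nhds hy] with z hz
    simp [max_eq_right hz.le]
  · rw [hasDerivAt_iff_isLittleO]
    simp only [max_self, mul_zero, sub_zero, smul_zero]
    refine Asymptotics.IsBigO.trans_isLittleO (g := fun z : ℝ => z ^ 2) ?_ ?_
    · refine Asymptotics.IsBigO.of_bound 1 (.of_forall fun z => ?_)
      rcases le_total z 0 with hz | hz <;> simp [hz, sq_nonneg]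
    · exact Asymptotics.isLittleO_pow_id one_lt_two
  · rw [max_eq_left hy.le]
    have h : HasDerivAt (fun z : ℝ => z ^ 2) (2 * y) y := by simpa using hasDerivAt_pow 2 y
    refine h.congr_of_eventuallyEq ?_
    filter_upwards [lt_mem_nhds hy] with z hz
    simp [max_eq_left hz.le]

lemma hasDerivAt_nsqL2_max (hv : ContDiff ℝ (⊤ : ℕ∞) (Function.uncurry v)) (t : ℝ) :
    HasDerivAt (fun s => nsqL2 fun x => max (v s x) 0)
      (2 * ipL2 (fun x => max (v t x) 0) (Dt v t)) t := by
  have hm : Continuous fun z : ℝ × ℝ => max (v z.1 z.2) 0 := hv.continuous.max continuous_const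
  have hd : Continuous fun z : ℝ × ℝ => Dt v z.1 z.2 := (contDiff_Dt hv).continuous
  have h := hasDerivAt_integral_of_continuous (F := fun s x => max (v s x) 0 ^ 2)
    (F' := fun s x => 2 * max (v s x) 0 * Dt v s x)
    (show Continuous fun z : ℝ × ℝ => max (v z.1 z.2) 0 ^ 2 by fun_prop)
    (show Continuous fun z : ℝ × ℝ => 2 * max (v z.1 z.2) 0 * Dt v z.1 z.2 by fun_prop)
    (fun s x => HasDerivAt.comp (h₂ := fun y : ℝ => max y 0 ^ 2) s (hasDerivAt_max_sq (v s x))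
      (hasDerivAt_Dt hv s x)) t
  simp only [mul_assoc, intervalIntegral.integral_const_mul] at h
  exact h

/-- Integration by parts against a function vanishing at both end points. -/
lemma ipL2_Dx (hv : ContDiff ℝ (⊤ : ℕ∞) (Function.uncurry v))
    (hw : ContDiff ℝ (⊤ : ℕ∞) (Function.uncurry w)) {t : ℝ} (h0 : v t 0 = 0) (h1 : v t 1 = 0) :
    ipL2 (v t) (Dx w t) = -ipL2 (Dx v t) (w t) := by
  have h := intervalIntegral.integral_mul_deriv_eq_deriv_mul (a := 0) (b := 1)
    (fun x _ => hasDerivAt_Dx hv t x) (fun x _ => hasDerivAt_Dx hw t x)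
    ((continuous_slice (contDiff_Dx hv).continuous t).intervalIntegrable _ _)
    ((continuous_slice (contDiff_Dx hw).continuous t).intervalIntegrable _ _)
  simpa [ipL2, h0, h1] using h

end Calculus

section Inequalities

lemma nsqL2_nonneg (f : ℝ → ℝ) : 0 ≤ nsqL2 f :=
  intervalIntegral.integral_nonneg zero_le_one fun _ _ => sq_nonneg _

lemma nsqL2_max_le {f : ℝ → ℝ} (hf : Continuous f) : nsqL2 (fun x => max (f x) 0) ≤ nsqL2 f := by
  refine intervalIntegral.integral_mono_on zero_le_one
    (Continuous.intervalIntegrable (by fun_prop) _ _)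
    (Continuous.intervalIntegrable (by fun_prop) _ _) fun x _ => ?_
  rcases le_total (f x) 0 with hx | hx <;> simp [hx, sq_nonneg]

lemma ipL2_self_max (f : ℝ → ℝ) :
    ipL2 f (fun x => max (f x) 0) = nsqL2 (fun x => max (f x) 0) := by
  refine intervalIntegral.integral_congr fun x _ => ?_
  rcases le_total (f x) 0 with hx | hx <;> simp [hx, sq]

lemma nsqL2_add_smul {f g : ℝ → ℝ} (hf : Continuous f) (hg : Continuous g) (a : ℝ) :
    nsqL2 (fun x => g x + a * f x) = nsqL2 g + 2 * a * ipL2 f g + a ^ 2 * nsqL2 f := by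
  have h : ∀ x, (g x + a * f x) ^ 2 = (g x ^ 2 + 2 * a * (f x * g x)) + a ^ 2 * f x ^ 2 :=
    fun x => by ring
  simp only [nsqL2, ipL2, h]
  rw [intervalIntegral.integral_add, intervalIntegral.integral_add,
    intervalIntegral.integral_const_mul, intervalIntegral.integral_const_mul] <;>
  exact Continuous.intervalIntegrable (by fun_prop) _ _

lemma sq_mul_nsqL2_le_of_lt_pi {f f' : ℝ → ℝ} (hf : ∀ x, HasDerivAt f (f' x) x)
    (hf' : Continuous f') (h0 : f 0 = 0) (h1 : f 1 = 0) {θ : ℝ} (hθ : 0 < θ) (hθπ : θ < π) :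
    θ ^ 2 * nsqL2 f ≤ nsqL2 f' := by
  have hfc : Continuous f := continuous_iff_continuousAt.2 fun x => (hf x).continuousAt
  have hcos : ∀ x ∈ Set.Icc (0:ℝ) 1, cos (θ * (x - 1 / 2)) ≠ 0 := fun x hx =>
    (cos_pos_of_mem_Ioo ⟨by nlinarith [hx.1], by nlinarith [hx.2]⟩).ne'
  set T : ℝ → ℝ := fun x => tan (θ * (x - 1 / 2)) with hT
  have hT' : ∀ x ∈ Set.Icc (0:ℝ) 1, HasDerivAt T ((1 + T x ^ 2) * θ) x := fun x hx => by
    have h := (hasDerivAt_tan (hcos x hx)).comp x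
      (((hasDerivAt_id x).sub_const (1 / 2)).const_mul θ)
    refine h.congr_deriv ?_
    simp only [hT]
    rw [mul_one, ← inv_one_add_tan_sq (hcos x hx), one_div, inv_inv]
  have hTc : ContinuousOn T (Set.Icc 0 1) := fun x hx => (hT' x hx).continuousAt.continuousWithinAt
  have key := intervalIntegral.integral_eq_sub_of_hasDerivAt (a := 0) (b := 1)
    (f := fun x => θ * (T x * f x ^ 2))
    (f' := fun x => θ * ((1 + T x ^ 2) * θ * f x ^ 2 + T x * (2 * f x * f' x)))
    (fun x hx => by
      rw [Set.uIcc_of_le zero_le_one] at hx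
      exact (((hT' x hx).mul ((hf x).pow 2)).const_mul θ).congr_deriv (by simp))
    (ContinuousOn.intervalIntegrable (by
      rw [Set.uIcc_of_le zero_le_one]
      fun_prop))
  simp only [h0, h1] at key
  have hle : ∫ x in (0:ℝ)..1, (θ ^ 2 * f x ^ 2) ≤ ∫ x in (0:ℝ)..1, (f' x ^ 2 +
      θ * ((1 + T x ^ 2) * θ * f x ^ 2 + T x * (2 * f x * f' x))) := by
    refine intervalIntegral.integral_mono_on zero_le_one
      (Continuous.intervalIntegrable (by fun_prop) _ _)
      (ContinuousOn.intervalIntegrable ?_) fun x _ => ?_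
    · rw [Set.uIcc_of_le zero_le_one]
      fun_prop
    · nlinarith [sq_nonneg (f' x + θ * T x * f x)]
  rw [intervalIntegral.integral_const_mul, intervalIntegral.integral_add, key] at hle
  · simpa [nsqL2] using hle
  · exact Continuous.intervalIntegrable (by fun_prop) _ _
  · refine ContinuousOn.intervalIntegrable ?_
    rw [Set.uIcc_of_le zero_le_one]
    fun_prop

/-- Sharp Poincaré inequality with Dirichlet boundary conditions. -/
lemma pi_sq_mul_nsqL2_le {f f' : ℝ → ℝ} (hf : ∀ x, HasDerivAt f (f' x) x)
    (hf' : Continuous f') (h0 : f 0 = 0) (h1 : f 1 = 0) : π ^ 2 * nsqL2 f ≤ nsqL2 f' := by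
  have hlim : Filter.Tendsto (fun θ : ℝ => θ ^ 2 * nsqL2 f) (nhdsWithin π (Set.Iio π))
      (nhds (π ^ 2 * nsqL2 f)) :=
    (Continuous.tendsto (by fun_prop) π).mono_left nhdsWithin_le_nhds
  refine le_of_tendsto hlim ?_
  filter_upwards [Ioo_mem_nhdsLT pi_pos] with θ hθ
  exact sq_mul_nsqL2_le_of_lt_pi hf hf' h0 h1 hθ.1 hθ.2

lemma le_exp_of_deriv_le {L L' : ℝ → ℝ} {c : ℝ} (hL : ∀ t, HasDerivAt L (L' t) t)
    (h : ∀ t > 0, L' t ≤ -c * L t) {t : ℝ} (ht : 0 ≤ t) : L t ≤ L 0 * exp (-c * t) := by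
  have hd : ∀ s, HasDerivAt (fun s => L s * exp (c * s))
      (L' s * exp (c * s) + L s * (exp (c * s) * c)) s := fun s =>
    ((hL s).mul ((hasDerivAt_id s).const_mul c).exp).congr_deriv (by simp)
  have hanti : AntitoneOn (fun s => L s * exp (c * s)) (Set.Ici 0) := by
    refine antitoneOn_of_deriv_nonpos (convex_Ici 0)
      (fun s _ => (hd s).continuousAt.continuousWithinAt)
      (fun s _ => (hd s).differentiableAt.differentiableWithinAt) fun s hs => ?_
    rw [interior_Ici] at hs
    rw [(hd s).deriv]
    nlinarith [h s hs, exp_pos (c * s)]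
  have := hanti (Set.self_mem_Ici) ht ht
  simp only [mul_zero, exp_zero, mul_one] at this
  calc L t = L t * exp (c * t) * exp (-c * t) := by
        rw [mul_assoc, ← exp_add]
        simp
    _ ≤ L 0 * exp (-c * t) := by gcongr

end Inequalities

section Bridge

variable {p k : ℝ} {u : ℝ → ℝ → ℝ}

/-- The energy, up to a constant. -/
def shiftedEnergy (p k : ℝ) (u : ℝ → ℝ → ℝ) (t : ℝ) : ℝ :=
  nsqL2 (Dt u t) + nsqL2 (Dx (Dx u) t) + (1 / 2) * nsqL2 (Dx u t) ^ 2 - p * nsqL2 (Dx u t)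
    + k ^ 2 * nsqL2 (fun x => max (u t x) 0)

namespace IsClassicalSolution

lemma ipL2_Dt_Dt (hu : IsClassicalSolution p k (fun _ _ => 0) u) {t : ℝ} (ht : 0 ≤ t)
    {v : ℝ → ℝ} (hv : Continuous v) :
    ipL2 v (Dt (Dt u) t) = -ipL2 v (Dx (Dx (Dx (Dx u))) t)
      - (p - nsqL2 (Dx u t)) * ipL2 v (Dx (Dx u) t) - ipL2 v (Dt u t)
      - k ^ 2 * ipL2 v (fun x => max (u t x) 0) := by
  obtain ⟨hs, hpde, -⟩ := hu
  have h0 := continuous_slice hs.continuous t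
  have h1 := continuous_slice (contDiff_Dt hs).continuous t
  have h2 := continuous_slice (contDiff_Dx (contDiff_Dx hs)).continuous t
  have h4 := continuous_slice (contDiff_Dx (contDiff_Dx (contDiff_Dx (contDiff_Dx hs)))).continuous t
  have h : ipL2 v (Dt (Dt u) t) = ∫ x in (0:ℝ)..1, (-(v x * Dx (Dx (Dx (Dx u))) t x)
      - (p - nsqL2 (Dx u t)) * (v x * Dx (Dx u) t x) - v x * Dt u t x
      - k ^ 2 * (v x * max (u t x) 0)) := by
    refine intervalIntegral.integral_congr fun x hx => ?_
    rw [Set.uIcc_of_le zero_le_one] at hx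
    linear_combination v x * hpde t ht x hx
  rw [h, intervalIntegral.integral_sub, intervalIntegral.integral_sub,
    intervalIntegral.integral_sub, intervalIntegral.integral_neg,
    intervalIntegral.integral_const_mul, intervalIntegral.integral_const_mul]
  · rfl
  all_goals exact Continuous.intervalIntegrable (by fun_prop) _ _

lemma Dt_boundary (hu : IsClassicalSolution p k (fun _ _ => 0) u) {t : ℝ} (ht : 0 < t) :
    Dt u t 0 = 0 ∧ Dt u t 1 = 0 := by
  constructor <;>
  · refine ((hasDerivAt_const t (0:ℝ)).congr_of_eventuallyEq ?_).deriv
    filter_upwards [lt_mem_nhds ht] with s hs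
    simp [hu.2.2 s hs.le]

lemma hasDerivAt_shiftedEnergy (hu : IsClassicalSolution p k (fun _ _ => 0) u) (t : ℝ) :
    HasDerivAt (shiftedEnergy p k u) (2 * ipL2 (Dt u t) (Dt (Dt u) t)
      + 2 * ipL2 (Dx (Dx u) t) (Dx (Dx (Dt u)) t)
      + (nsqL2 (Dx u t) - p) * (2 * ipL2 (Dx u t) (Dx (Dt u) t))
      + k ^ 2 * (2 * ipL2 (fun x => max (u t x) 0) (Dt u t))) t := by
  have hs := hu.1
  have hx := hasDerivAt_nsqL2 (contDiff_Dx hs) t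
  have hxx := hasDerivAt_nsqL2 (contDiff_Dx (contDiff_Dx hs)) t
  rw [Dt_Dx_comm hs] at hx
  rw [Dt_Dx_comm (contDiff_Dx hs), Dt_Dx_comm hs] at hxx
  refine (((((hasDerivAt_nsqL2 (contDiff_Dt hs) t).add hxx).add
    ((hx.pow 2).const_mul (1 / 2))).sub (hx.const_mul p)).add
    ((hasDerivAt_nsqL2_max hs t).const_mul (k ^ 2))).congr_deriv ?_
  push_cast
  ring

lemma hasDerivAt_shiftedEnergy_dissipation (hu : IsClassicalSolution p k (fun _ _ => 0) u)
    {t : ℝ} (ht : 0 < t) :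
    HasDerivAt (shiftedEnergy p k u) (-2 * nsqL2 (Dt u t)) t := by
  have hs := hu.1
  have hsx := contDiff_Dx hs
  have hsxx := contDiff_Dx hsx
  have hst := contDiff_Dt hs
  obtain ⟨b0, b1⟩ := hu.Dt_boundary ht
  obtain ⟨-, -, c0, c1⟩ := hu.2.2 t ht.le
  have e1 := ipL2_Dx hst (contDiff_Dx hsxx) b0 b1
  have e2 := ipL2_Dx hsxx (contDiff_Dx hst) c0 c1
  have e3 := ipL2_Dx hst hsx b0 b1
  have e4 := hu.ipL2_Dt_Dt ht.le (continuous_slice hst.continuous t)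
  refine (hu.hasDerivAt_shiftedEnergy t).congr_deriv ?_
  rw [e4, e1, e2, e3, ipL2_comm (Dx (Dx (Dx u)) t), ipL2_comm (Dx u t),
    ipL2_comm (fun x => max (u t x) 0), ← nsqL2_eq_ipL2]
  ring

lemma ipL2_Dx_Dx (hu : IsClassicalSolution p k (fun _ _ => 0) u) {t : ℝ} (ht : 0 ≤ t) :
    ipL2 (u t) (Dx (Dx u) t) = -nsqL2 (Dx u t) := by
  obtain ⟨b0, b1, -, -⟩ := hu.2.2 t ht
  rw [ipL2_Dx hu.1 (contDiff_Dx hu.1) b0 b1, nsqL2_eq_ipL2]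

/-- The multiplier identity obtained by testing the equation with `u`. -/
lemma hasDerivAt_multiplier (hu : IsClassicalSolution p k (fun _ _ => 0) u) {t : ℝ} (ht : 0 < t) :
    HasDerivAt (fun s => ipL2 (u s) (Dt u s) + (1 / 2) * nsqL2 (u s))
      (nsqL2 (Dt u t) - nsqL2 (Dx (Dx u) t) + p * nsqL2 (Dx u t) - nsqL2 (Dx u t) ^ 2
        - k ^ 2 * nsqL2 (fun x => max (u t x) 0)) t := by
  have hs := hu.1
  have hsx := contDiff_Dx hs
  have hsxx := contDiff_Dx hsx
  obtain ⟨b0, b1, c0, c1⟩ := hu.2.2 t ht.le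
  have e1 := ipL2_Dx hs (contDiff_Dx hsxx) b0 b1
  have e2 := ipL2_Dx hsxx hsx c0 c1
  have e4 := hu.ipL2_Dt_Dt ht.le (continuous_slice hs.continuous t)
  refine ((hasDerivAt_ipL2 hs (contDiff_Dt hs) t).add
    ((hasDerivAt_nsqL2 hs t).const_mul (1 / 2))).congr_deriv ?_
  rw [e4, e1, ipL2_comm (Dx u t), ← neg_eq_iff_eq_neg.2 e2, hu.ipL2_Dx_Dx ht.le, ipL2_self_max,
    ← nsqL2_eq_ipL2, ← nsqL2_eq_ipL2]
  ring

lemma poincare (hu : IsClassicalSolution p k (fun _ _ => 0) u) {t : ℝ} (ht : 0 ≤ t) :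
    π ^ 2 * nsqL2 (u t) ≤ nsqL2 (Dx u t) := by
  obtain ⟨b0, b1, -, -⟩ := hu.2.2 t ht
  exact pi_sq_mul_nsqL2_le (hasDerivAt_Dx hu.1 t)
    (continuous_slice (contDiff_Dx hu.1).continuous t) b0 b1

lemma poincare_Dx (hu : IsClassicalSolution p k (fun _ _ => 0) u) {t : ℝ} (ht : 0 ≤ t) :
    π ^ 2 * nsqL2 (Dx u t) ≤ nsqL2 (Dx (Dx u) t) := by
  have h := nsqL2_nonneg fun x => Dx (Dx u) t x + π ^ 2 * u t x
  rw [nsqL2_add_smul (continuous_slice hu.1.continuous t)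
    (continuous_slice (contDiff_Dx (contDiff_Dx hu.1)).continuous t), hu.ipL2_Dx_Dx ht] at h
  nlinarith [hu.poincare ht, pi_pos, sq_nonneg π]

end IsClassicalSolution

end Bridge

/-- Exponential decay for subcritical axial load: if `p < π²` and `f ≡ 0`, then for
every `R > 0` there are `c₀ ≥ 1` and `c > 0`, depending only on `R, p, k`, such that
every classical solution with `𝓔(0) ≤ R` satisfies `𝓔(t) ≤ c₀𝓔(0)e^{−ct}`. -/
theorem exponential_decay (p k : ℝ) (hp : p < π ^ 2) :
    ∀ R > (0:ℝ), ∃ c₀ ≥ (1:ℝ), ∃ c > (0:ℝ),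
      ∀ u : ℝ → ℝ → ℝ, IsClassicalSolution p k (fun _ _ => 0) u →
        redEnergy u 0 ≤ R →
        ∀ t ≥ (0:ℝ), redEnergy u t ≤ c₀ * redEnergy u 0 * Real.exp (-c * t) := by
  intro R hR
  have hπ : 1 ≤ π ^ 2 := by nlinarith [pi_gt_three]
  obtain ⟨δ, hδ, hδ1, hδp⟩ : ∃ δ > 0, δ ≤ 1 ∧ p ≤ (1 - δ) * π ^ 2 := by
    rcases le_total p 0 with h | h
    · exact ⟨1, one_pos, le_rfl, by simpa using h⟩
    · refine ⟨1 - p / π ^ 2, ?_, ?_, ?_⟩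
      · rw [gt_iff_lt, sub_pos, div_lt_one (by positivity)]
        exact hp
      · have : 0 ≤ p / π ^ 2 := by positivity
        linarith
      · field_simp
        simp
  set M := 1 + R + |p| + k ^ 2 with hM
  have hM1 : 1 ≤ M := by
    have := abs_nonneg p
    nlinarith [sq_nonneg k]
  refine ⟨3 / δ * M, ?_, δ / 3, by positivity, fun u hu hR0 t ht => ?_⟩
  · have : 1 ≤ 3 / δ := by
      rw [le_div_iff₀ hδ]
      linarith
    exact one_le_mul_of_one_le_of_one_le this hM1
  have hcoer : ∀ s ≥ 0, δ * redEnergy u s ≤ shiftedEnergy p k u s := fun s hs => by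
    have h1 := hu.poincare_Dx hs
    have ha := nsqL2_nonneg (Dt u s)
    have hg := nsqL2_nonneg (Dx u s)
    have hm := mul_nonneg (sq_nonneg k) (nsqL2_nonneg fun x => max (u s x) 0)
    have h2 := mul_le_mul_of_nonneg_right hδp hg
    have h3 := mul_le_mul_of_nonneg_left h1 (sub_nonneg.2 hδ1)
    have h4 := mul_le_mul_of_nonneg_right hδ1 ha
    unfold redEnergy shiftedEnergy
    nlinarith [sq_nonneg (nsqL2 (Dx u s))]
  have hcross : ∀ s ≥ 0,
      |ipL2 (u s) (Dt u s) + 1 / 2 * nsqL2 (u s)| ≤ redEnergy u s := fun s hs => by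
    have h1 := hu.poincare_Dx hs
    have h2 := hu.poincare hs
    have ha := nsqL2_nonneg (Dt u s)
    have hg := nsqL2_nonneg (Dx u s)
    have hn := nsqL2_nonneg (u s)
    have hc := continuous_slice hu.1.continuous s
    have hc' := continuous_slice (contDiff_Dt hu.1).continuous s
    have hplus := nsqL2_nonneg fun x => Dt u s x + 1 * u s x
    have hminus := nsqL2_nonneg fun x => Dt u s x + -1 * u s x
    rw [nsqL2_add_smul hc hc'] at hplus hminus
    unfold redEnergy
    rw [abs_le]
    constructor <;> nlinarith
  have hupper : shiftedEnergy p k u 0 ≤ M * redEnergy u 0 := by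
    have h1 := hu.poincare_Dx le_rfl
    have h2 := hu.poincare le_rfl
    have ha := nsqL2_nonneg (Dt u 0)
    have hg := nsqL2_nonneg (Dx u 0)
    have hn := nsqL2_nonneg (u 0)
    have hm := mul_le_mul_of_nonneg_left
      (nsqL2_max_le (continuous_slice hu.1.continuous 0)) (sq_nonneg k)
    have hgE : nsqL2 (Dx u 0) ≤ redEnergy u 0 := by
      unfold redEnergy
      nlinarith
    have hnE : nsqL2 (u 0) ≤ redEnergy u 0 := by nlinarith
    have h3 : -p * nsqL2 (Dx u 0) ≤ |p| * redEnergy u 0 :=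
      mul_le_mul (neg_le_abs p) hgE hg (abs_nonneg p)
    have h4 := mul_le_mul_of_nonneg_left hnE (sq_nonneg k)
    have h5 : nsqL2 (Dx u 0) ^ 2 ≤ R * redEnergy u 0 := by
      rw [sq]
      exact mul_le_mul (hgE.trans hR0) hgE hg hR.le
    have h6 := sq_nonneg (nsqL2 (Dx u 0))
    have h7 : shiftedEnergy p k u 0 = redEnergy u 0 + 1 / 2 * nsqL2 (Dx u 0) ^ 2
        - p * nsqL2 (Dx u 0) + k ^ 2 * nsqL2 (fun x => max (u 0 x) 0) := rfl
    rw [h7, hM]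
    linarith
  set G : ℝ → ℝ := fun s => ipL2 (u s) (Dt u s) + 1 / 2 * nsqL2 (u s) with hG
  set L : ℝ → ℝ := fun s => shiftedEnergy p k u s + δ / 2 * G s with hL
  have hbounds : ∀ s ≥ 0, shiftedEnergy p k u s ≤ 2 * L s ∧
      L s ≤ 3 / 2 * shiftedEnergy p k u s := fun s hs => by
    have h1 := mul_le_mul_of_nonneg_left (hcross s hs) hδ.le
    have h2 := hcoer s hs
    have h3 := mul_le_mul_of_nonneg_left (neg_abs_le (G s)) hδ.le
    have h4 := mul_le_mul_of_nonneg_left (le_abs_self (G s)) hδ.le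
    simp only [hL]
    constructor <;> linarith
  have hLc : ∀ s, DifferentiableAt ℝ L s := fun s =>
    ((hu.hasDerivAt_shiftedEnergy s).differentiableAt).add
      (((hasDerivAt_ipL2 hu.1 (contDiff_Dt hu.1) s).add
        ((hasDerivAt_nsqL2 hu.1 s).const_mul (1 / 2))).differentiableAt.const_mul (δ / 2))
  have hdecay : L t ≤ L 0 * exp (-(δ / 3) * t) := by
    refine le_exp_of_deriv_le (fun s => (hLc s).hasDerivAt) (fun s hs => ?_) ht
    have h := (hu.hasDerivAt_shiftedEnergy_dissipation hs).add
      ((hu.hasDerivAt_multiplier hs).const_mul (δ / 2))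
    have h' : deriv L s = _ := h.deriv
    have ha := nsqL2_nonneg (Dt u s)
    have hLF := (hbounds s hs.le).2
    have h1 : deriv L s ≤ -(δ / 2) * shiftedEnergy p k u s := by
      rw [h']
      unfold shiftedEnergy
      nlinarith [mul_nonneg hδ.le (sq_nonneg (nsqL2 (Dx u s))),
        mul_le_mul_of_nonneg_right hδ1 ha]
    have h2 := mul_le_mul_of_nonneg_left hLF hδ.le
    linarith
  have h1 := hcoer t ht
  have h2 := (hbounds t ht).1
  have h3 := (hbounds 0 le_rfl).2
  have h4 : δ * redEnergy u t ≤ 3 * M * redEnergy u 0 * exp (-(δ / 3) * t) :=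
    calc δ * redEnergy u t ≤ 2 * L t := h1.trans h2
      _ ≤ 2 * L 0 * exp (-(δ / 3) * t) := by linarith
      _ ≤ 3 * M * redEnergy u 0 * exp (-(δ / 3) * t) := by
        refine mul_le_mul_of_nonneg_right ?_ (exp_pos _).le
        linarith
  calc redEnergy u t = δ * redEnergy u t / δ := by field_simp
    _ ≤ 3 * M * redEnergy u 0 * exp (-(δ / 3) * t) / δ := by gcongr
    _ = 3 / δ * M * redEnergy u 0 * exp (-(δ / 3) * t) := by ring
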